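/- Every field isomorphism between finitely generated subfields of ℂ extends to a field automorphism of ℂ: if L and L' are subfields of ℂ that are each generated (as fields) by finitely many complex numbers, and σ : L → L' is a field isomorphism, then there exists a field automorphism τ of ℂ whose restriction to L equals σ. -/

import Mathlib

universe u

/-- An isomorphism over `K` between algebraically closed fields with equipotent transcendence
bases over `K`. -/
theorem IsTranscendenceBasis.nonempty_algEquiv {K A B ι κ : Type*} [Field K] [Field A] [Field B]
    [Algebra K A] [Algebra K B] [IsAlgClosed A] [IsAlgClosed B] {v : ι → A} {w : κ → B}
    (hv : IsTranscendenceBasis K v) (hw : IsTranscendenceBasis K w) (e : ι ≃ κ) :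
    Nonempty (A ≃ₐ[K] B) := by
  have := IsAlgClosed.isAlgClosure_of_transcendence_basis v hv
  have := IsAlgClosed.isAlgClosure_of_transcendence_basis w hw
  let f : Algebra.adjoin K (Set.range v) ≃ₐ[K] Algebra.adjoin K (Set.range w) :=
    hv.1.aevalEquiv.symm.trans ((MvPolynomial.renameEquiv K e).trans hw.1.aevalEquiv)
  refine ⟨AlgEquiv.ofRingEquiv (f := IsAlgClosure.equivOfEquiv A B f.toRingEquiv) fun x => ?_⟩
  have h := IsAlgClosure.equivOfEquiv_algebraMap A B f.toRingEquiv
    (algebraMap K (Algebra.adjoin K (Set.range v)) x)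
  rw [← IsScalarTower.algebraMap_apply] at h
  rw [h]
  exact congrArg Subtype.val (f.commutes x)

open Cardinal in
/-- Two uncountable algebraically closed fields of the same cardinality are isomorphic over any
countable field embedded in both of them. -/
theorem IsAlgClosed.nonempty_algEquiv_of_countable {K : Type*} {A B : Type u} [Field K]
    [Countable K] [Field A] [Field B] [Algebra K A] [Algebra K B] [IsAlgClosed A] [IsAlgClosed B]
    (hA : ℵ₀ < #A) (hAB : #A = #B) : Nonempty (A ≃ₐ[K] B) := by
  obtain ⟨s, hs⟩ := exists_isTranscendenceBasis K A
  obtain ⟨t, ht⟩ := exists_isTranscendenceBasis K B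
  have hsA := cardinal_eq_cardinal_transcendence_basis_of_aleph0_lt _ hs mk_le_aleph0 hA
  have htB := cardinal_eq_cardinal_transcendence_basis_of_aleph0_lt _ ht mk_le_aleph0 (hAB ▸ hA)
  obtain ⟨e⟩ := Cardinal.eq.1
    (lift_injective (hsA.symm.trans ((congrArg Cardinal.lift hAB).trans htB)))
  exact hs.nonempty_algEquiv ht e

open Cardinal in
/-- Embeddings of a countable field into two uncountable algebraically closed fields of the same
cardinality differ by an isomorphism of the latter. -/
theorem IsAlgClosed.exists_ringEquiv_apply_eq {K : Type*} {A B : Type u} [Field K] [Countable K]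
    [Field A] [Field B] [IsAlgClosed A] [IsAlgClosed B] (hA : ℵ₀ < #A) (hAB : #A = #B)
    (i : K →+* A) (j : K →+* B) : ∃ τ : A ≃+* B, ∀ x, τ (i x) = j x := by
  let := i.toAlgebra
  let := j.toAlgebra
  obtain ⟨τ⟩ := nonempty_algEquiv_of_countable (K := K) hA hAB
  exact ⟨τ.toRingEquiv, τ.commutes⟩

/-- every field isomorphism between finitely generated subfields of `ℂ`
extends to a field automorphism of `ℂ`. -/
theorem extend_iso_of_fg_subfields (L L' : Subfield ℂ)
    (hL : ∃ s : Finset ℂ, L = Subfield.closure (s : Set ℂ))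
    (hL' : ∃ s : Finset ℂ, L' = Subfield.closure (s : Set ℂ))
    (σ : L ≃+* L') :
    ∃ τ : ℂ ≃+* ℂ, ∀ x : L, τ (x : ℂ) = ((σ x : L') : ℂ) := by
  obtain ⟨s, rfl⟩ := hL
  have : Countable (Subfield.closure (s : Set ℂ)) := by
    have h := Subfield.cardinalMk_closure_le_max (s : Set ℂ)
    exact Cardinal.mk_le_aleph0_iff.1 (h.trans (max_le Cardinal.mk_le_aleph0 le_rfl))
  exact IsAlgClosed.exists_ringEquiv_apply_eq
    (by rw [Cardinal.mk_complex]; exact Cardinal.aleph0_lt_continuum) rfl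
    (Subfield.closure (s : Set ℂ)).subtype (L'.subtype.comp σ.toRingHom)
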